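/- Let α > 1 and β > 0, let φ be an analytic self-map of the open unit disk D, and let g be analytic on D. Then the operator V_gC_φ, defined by (V_gC_φ f)(z) = ∫₀^z f'(φ(ξ)) g(ξ) dξ, is bounded from Z^α to Z^β if and only if sup_{z∈D} (1−|z|²)^β |g(z)φ'(z)| / (1−|φ(z)|²)^α < ∞ and sup_{z∈D} (1−|z|²)^β |g'(z)| / (1−|φ(z)|²)^{α−1} < ∞. -/

import Mathlib

noncomputable section

/-- The open unit disk in the complex plane. -/
def uD : Set ℂ := Metric.ball 0 1

/-- The Zygmund-type quantity `(1-|z|^2)^a * |f''(z)|`. -/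
def zygS (a : ℝ) (f : ℂ → ℂ) (z : ℂ) : ℝ := (1 - ‖z‖ ^ 2) ^ a * ‖deriv (deriv f) z‖

/-- Membership in the Zygmund-type space `Z^a`. -/
def memZ (a : ℝ) (f : ℂ → ℂ) : Prop :=
  AnalyticOn ℂ f uD ∧ ∃ M : ℝ, ∀ z ∈ uD, zygS a f z ≤ M

/-- The Zygmund-type norm `‖f‖_{Z^a} = |f 0| + |f' 0| + sup_{z ∈ D} (1-|z|^2)^a |f''(z)|`. -/
def zNorm (a : ℝ) (f : ℂ → ℂ) : ℝ := ‖f 0‖ + ‖deriv f 0‖ + sSup (zygS a f '' uD)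

/-- Membership in the weighted space `H^∞_{v_b}` (for `u` analytic on `uD`). -/
def memHv (b : ℝ) (u : ℂ → ℂ) : Prop :=
  ∃ M : ℝ, ∀ z ∈ uD, (1 - ‖z‖ ^ 2) ^ b * ‖u z‖ ≤ M

/-- `T` is a bounded operator from `Z^a` to `Z^b`. -/
def boundedOp (a b : ℝ) (T : (ℂ → ℂ) → ℂ → ℂ) : Prop :=
  (∀ f, memZ a f → memZ b (T f)) ∧
    ∃ C > 0, ∀ f, memZ a f → zNorm b (T f) ≤ C * zNorm a f

/-- `(V_g C_φ f)(z) = ∫₀^z f'(φ(ξ)) g(ξ) dξ`, parametrized along the segment from `0` to `z`. -/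
def VgCphi (g φ : ℂ → ℂ) (f : ℂ → ℂ) : ℂ → ℂ :=
  fun z => ∫ t in (0:ℝ)..1, z * (deriv f (φ ((t : ℂ) * z)) * g ((t : ℂ) * z))

lemma isOpen_uD : IsOpen uD := Metric.isOpen_ball

lemma mem_uD {z : ℂ} : z ∈ uD ↔ ‖z‖ < 1 := by simp [uD]

lemma w_pos {z : ℂ} (hz : z ∈ uD) : 0 < 1 - ‖z‖ ^ 2 := by
  have := mem_uD.1 hz
  nlinarith [norm_nonneg z]

lemma smul_mem_uD {z : ℂ} (hz : z ∈ uD) {t : ℝ} (ht : t ∈ Set.Icc (0:ℝ) 1) : (t : ℂ) * z ∈ uD := by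
  have := mem_uD.1 hz
  rw [mem_uD, norm_mul, Complex.norm_real, Real.norm_of_nonneg ht.1]
  nlinarith [norm_nonneg z, ht.1, ht.2]

lemma analytic_nhd {f : ℂ → ℂ} (hf : AnalyticOn ℂ f uD) : AnalyticOnNhd ℂ f uD :=
  isOpen_uD.analyticOn_iff_analyticOnNhd.1 hf

lemma hasDeriv_path {H h : ℂ → ℂ} (hH : ∀ z ∈ uD, HasDerivAt H (h z) z) {z : ℂ} (hz : z ∈ uD)
    {t : ℝ} (ht : t ∈ Set.Icc (0:ℝ) 1) :
    HasDerivAt (fun t : ℝ => H ((t : ℂ) * z)) (z * h ((t : ℂ) * z)) t := by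
  have h1 := hH _ (smul_mem_uD hz ht)
  have h2 : HasDerivAt (fun s : ℂ => s * z) z (t : ℂ) := by
    simpa using (hasDerivAt_id (t : ℂ)).mul_const z
  have h3 := (HasDerivAt.comp (t : ℂ) h1 h2).comp_ofReal
  rw [mul_comm]
  exact h3

lemma T_props {φ g f : ℂ → ℂ} (hφ : AnalyticOn ℂ φ uD) (hφm : Set.MapsTo φ uD uD)
    (hg : AnalyticOn ℂ g uD) (hf : AnalyticOn ℂ f uD) :
    (∀ z ∈ uD, HasDerivAt (VgCphi g φ f) (deriv f (φ z) * g z) z) := by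
  have han : AnalyticOnNhd ℂ (fun z => deriv f (φ z) * g z) uD :=
    ((analytic_nhd hf).deriv.comp (analytic_nhd hφ) hφm).mul (analytic_nhd hg)
  obtain ⟨H, hH⟩ := DifferentiableOn.isExactOn_ball (c := 0) (r := 1) han.differentiableOn
  have key : ∀ z ∈ uD, VgCphi g φ f z = H z - H 0 := by
    intro z hz
    have := intervalIntegral.integral_eq_sub_of_hasDerivAt (a := 0) (b := 1)
      (f := fun t : ℝ => H ((t : ℂ) * z))
      (f' := fun t : ℝ => z * (deriv f (φ ((t : ℂ) * z)) * g ((t : ℂ) * z)))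
      (fun t ht => hasDeriv_path (h := fun z => deriv f (φ z) * g z) hH hz
        (by simpa using ht)) ?_
    · simpa [VgCphi] using this
    · apply ContinuousOn.intervalIntegrable
      apply ContinuousOn.mul continuousOn_const
      refine han.continuousOn.comp (f := fun t : ℝ => (t : ℂ) * z) (by fun_prop) ?_
      intro t ht
      exact smul_mem_uD hz (by simpa using ht)
  intro z hz
  refine ((hH z hz).sub_const (H 0)).congr_of_eventuallyEq ?_
  filter_upwards [isOpen_uD.mem_nhds hz] with w hw using key w hw

lemma T_deriv2 {φ g f : ℂ → ℂ} (hφ : AnalyticOn ℂ φ uD) (hφm : Set.MapsTo φ uD uD)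
    (hg : AnalyticOn ℂ g uD) (hf : AnalyticOn ℂ f uD) {z : ℂ} (hz : z ∈ uD) :
    deriv (deriv (VgCphi g φ f)) z =
      deriv (deriv f) (φ z) * deriv φ z * g z + deriv f (φ z) * deriv g z := by
  have h1 : deriv (VgCphi g φ f) =ᶠ[nhds z] fun z => deriv f (φ z) * g z := by
    filter_upwards [isOpen_uD.mem_nhds hz] with w hw using (T_props hφ hφm hg hf w hw).deriv
  rw [h1.deriv_eq]
  have hd := ((analytic_nhd hf).deriv (φ z) (hφm hz)).differentiableAt.hasDerivAt
  have hp := ((analytic_nhd hφ) z hz).differentiableAt.hasDerivAt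
  have hgd := ((analytic_nhd hg) z hz).differentiableAt.hasDerivAt
  exact ((HasDerivAt.comp z hd hp).mul hgd).deriv

lemma T_zero (φ g f : ℂ → ℂ) : VgCphi g φ f 0 = 0 := by simp [VgCphi]

lemma zyg_nonneg {b : ℝ} {F : ℂ → ℂ} {z : ℂ} (hz : z ∈ uD) : 0 ≤ zygS b F z :=
  mul_nonneg (Real.rpow_nonneg (w_pos hz).le _) (norm_nonneg _)

lemma sSup_nn (b : ℝ) (F : ℂ → ℂ) : 0 ≤ sSup (zygS b F '' uD) := by
  apply Real.sSup_nonneg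
  rintro _ ⟨z, hz, rfl⟩
  exact zyg_nonneg hz

lemma zyg_le {b : ℝ} {F : ℂ → ℂ} (hF : memZ b F) {z : ℂ} (hz : z ∈ uD) : zygS b F z ≤ zNorm b F := by
  obtain ⟨_, M, hM⟩ := hF
  have : zygS b F z ≤ sSup (zygS b F '' uD) := by
    apply le_csSup
    · refine ⟨M, ?_⟩
      rintro _ ⟨w, hw, rfl⟩
      exact hM w hw
    · exact ⟨z, hz, rfl⟩
  unfold zNorm
  linarith [norm_nonneg (F 0), norm_nonneg (deriv F 0)]

lemma sSup_le_of {b : ℝ} {F : ℂ → ℂ} {M : ℝ} (hM : ∀ z ∈ uD, zygS b F z ≤ M) :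
    sSup (zygS b F '' uD) ≤ M := by
  apply csSup_le
  · exact ⟨_, 0, by simp [uD], rfl⟩
  · rintro _ ⟨w, hw, rfl⟩
    exact hM w hw

lemma test_fun {α K : ℝ} {h h' : ℂ → ℂ} (hh : ∀ z ∈ uD, HasDerivAt h (h' z) z)
    (hK : ∀ z ∈ uD, (1 - ‖z‖ ^ 2) ^ α * ‖h' z‖ ≤ K) (h0 : ‖h 0‖ ≤ 1) :
    ∃ f, memZ α f ∧ zNorm α f ≤ 1 + K ∧
      ∀ z ∈ uD, deriv f z = h z ∧ deriv (deriv f) z = h' z := by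
  have hd : DifferentiableOn ℂ h (Metric.ball 0 1) :=
    fun z hz => (hh z hz).differentiableAt.differentiableWithinAt
  obtain ⟨H, hH⟩ := hd.isExactOn_ball
  have hder : ∀ z ∈ uD, deriv (fun z => H z - H 0) z = h z := fun z hz =>
    ((hH z hz).sub_const (H 0)).deriv
  have hder2 : ∀ z ∈ uD, deriv (deriv (fun z => H z - H 0)) z = h' z := by
    intro z hz
    have : deriv (fun z => H z - H 0) =ᶠ[nhds z] h := by
      filter_upwards [isOpen_uD.mem_nhds hz] with w hw using hder w hw
    rw [this.deriv_eq, (hh z hz).deriv]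
  have hb : ∀ z ∈ uD, zygS α (fun z => H z - H 0) z ≤ K := by
    intro z hz
    rw [zygS, hder2 z hz]
    exact hK z hz
  refine ⟨fun z => H z - H 0, ⟨?_, K, hb⟩, ?_, fun z hz => ⟨hder z hz, hder2 z hz⟩⟩
  · apply AnalyticOnNhd.analyticOn
    apply DifferentiableOn.analyticOnNhd _ isOpen_uD
    exact fun z hz => ((hH z hz).sub_const (H 0)).differentiableAt.differentiableWithinAt
  · have := sSup_le_of hb
    rw [zNorm, hder 0 (by simp [uD])]
    simp only [sub_self, norm_zero]
    linarith

lemma growth {α : ℝ} (hα : 1 < α) {f : ℂ → ℂ} (hf : memZ α f) {w : ℂ} (hw : w ∈ uD) :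
    ‖deriv f w‖ ≤ (1 + 2 ^ (α - 1) / (α - 1)) * zNorm α f * (1 - ‖w‖ ^ 2) ^ (1 - α) := by
  set N := zNorm α f with hN
  have hN0 : 0 ≤ N := le_trans (zyg_nonneg hw) (zyg_le hf hw)
  have hw1 := mem_uD.1 hw
  have hwn := norm_nonneg w
  have hpos : ∀ t ∈ Set.Icc (0:ℝ) 1, 0 < 1 - t * ‖w‖ := by
    intro t ht
    nlinarith [ht.1, ht.2]
  have hα1 : 0 < α - 1 := by linarith
  have hB : ∀ t ∈ Set.Icc (0:ℝ) 1, HasDerivAt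
      (fun t : ℝ => N + N / (α - 1) * (1 - t * ‖w‖) ^ (1 - α)) (N * ‖w‖ * (1 - t * ‖w‖) ^ (-α)) t := by
    intro t ht
    have h1 : HasDerivAt (fun t : ℝ => 1 - t * ‖w‖) (-‖w‖) t := by
      simpa using ((hasDerivAt_id t).mul_const ‖w‖).const_sub 1
    have h2 := ((h1.rpow_const (p := 1 - α) (Or.inl (hpos t ht).ne')).const_mul (N / (α - 1))).const_add N
    have h3 : N / (α - 1) * (-‖w‖ * (1 - α) * (1 - t * ‖w‖) ^ (1 - α - 1)) =
        N * ‖w‖ * (1 - t * ‖w‖) ^ (-α) := by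
      rw [show 1 - α - 1 = -α by ring]
      field_simp
      ring
    rw [h3] at h2
    exact h2
  have hder : ∀ z ∈ uD, HasDerivAt (deriv f) (deriv (deriv f) z) z := fun z hz =>
    ((analytic_nhd hf.1).deriv z hz).differentiableAt.hasDerivAt
  have hp : ∀ t ∈ Set.Icc (0:ℝ) 1, HasDerivAt (fun t : ℝ => deriv f ((t : ℂ) * w))
      (w * deriv (deriv f) ((t : ℂ) * w)) t := fun t ht => hasDeriv_path hder hw ht
  have hmain := image_norm_le_of_norm_deriv_right_le_deriv_boundary' (a := 0) (b := 1)
    (f := fun t : ℝ => deriv f ((t : ℂ) * w))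
    (f' := fun t : ℝ => w * deriv (deriv f) ((t : ℂ) * w))
    (B := fun t : ℝ => N + N / (α - 1) * (1 - t * ‖w‖) ^ (1 - α))
    (B' := fun t : ℝ => N * ‖w‖ * (1 - t * ‖w‖) ^ (-α))
    (fun t ht => (hp t ht).continuousAt.continuousWithinAt)
    (fun t ht => (hp t (Set.Ico_subset_Icc_self ht)).hasDerivWithinAt)
    ?_
    (fun t ht => (hB t ht).continuousAt.continuousWithinAt)
    (fun t ht => (hB t (Set.Ico_subset_Icc_self ht)).hasDerivWithinAt)
    ?_ (Set.right_mem_Icc.2 zero_le_one)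
  · simp only [Complex.ofReal_one, one_mul] at hmain
    have hwp := w_pos hw
    have e1 : (1 - ‖w‖) ^ (1 - α) ≤ 2 ^ (α - 1) * (1 - ‖w‖ ^ 2) ^ (1 - α) := by
      have : ((1 - ‖w‖ ^ 2) / 2) ^ (1 - α) = 2 ^ (α - 1) * (1 - ‖w‖ ^ 2) ^ (1 - α) := by
        rw [Real.div_rpow hwp.le (by norm_num), div_eq_mul_inv, ← Real.rpow_neg (by norm_num),
          neg_sub, mul_comm]
      rw [← this]
      apply Real.rpow_le_rpow_of_nonpos (by positivity) _ (by linarith)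
      nlinarith
    have e2 : 1 ≤ (1 - ‖w‖ ^ 2) ^ (1 - α) :=
      Real.one_le_rpow_of_pos_of_le_one_of_nonpos hwp (by nlinarith) (by linarith)
    have e3 : N / (α - 1) * (1 - ‖w‖) ^ (1 - α) ≤
        N / (α - 1) * (2 ^ (α - 1) * (1 - ‖w‖ ^ 2) ^ (1 - α)) :=
      mul_le_mul_of_nonneg_left e1 (by positivity)
    have e4 := mul_le_mul_of_nonneg_left e2 hN0
    calc _ ≤ _ := hmain
      _ ≤ N * (1 - ‖w‖ ^ 2) ^ (1 - α) + N / (α - 1) * (2 ^ (α - 1) * (1 - ‖w‖ ^ 2) ^ (1 - α)) := by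
        linarith
      _ = _ := by ring
  · have : ‖deriv f 0‖ ≤ N := by
      rw [hN, zNorm]
      linarith [norm_nonneg (f 0), sSup_nn α f]
    have h3 : 0 ≤ N / (α - 1) := by positivity
    simp
    linarith
  · intro t ht
    have ht' := Set.Ico_subset_Icc_self ht
    have hm := smul_mem_uD hw ht'
    have hz := zyg_le hf hm
    rw [zygS] at hz
    have hnn : ‖(t : ℂ) * w‖ = t * ‖w‖ := by
      rw [norm_mul, Complex.norm_real, Real.norm_of_nonneg ht'.1]
    have hp1 := hpos t ht'
    have hge : (1 - t * ‖w‖) ^ α ≤ (1 - ‖(t : ℂ) * w‖ ^ 2) ^ α := by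
      apply Real.rpow_le_rpow hp1.le _ (by linarith)
      rw [hnn]
      nlinarith [mul_nonneg ht'.1 hwn]
    have h5 : ‖deriv (deriv f) ((t : ℂ) * w)‖ ≤ N * (1 - t * ‖w‖) ^ (-α) := by
      rw [Real.rpow_neg hp1.le, ← div_eq_mul_inv, le_div_iff₀ (Real.rpow_pos_of_pos hp1 _), mul_comm]
      exact le_trans (mul_le_mul_of_nonneg_right hge (norm_nonneg _)) hz
    rw [norm_mul]
    calc _ ≤ ‖w‖ * (N * (1 - t * ‖w‖) ^ (-α)) := mul_le_mul_of_nonneg_left h5 hwn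
      _ = _ := by ring

lemma norm_den {a z : ℂ} (ha : a ∈ uD) (hz : z ∈ uD) :
    (1 - ‖z‖ ^ 2) / 2 ≤ ‖1 - (starRingEnd ℂ) a * z‖ ∧
    1 - (starRingEnd ℂ) a * z ∈ Complex.slitPlane ∧ ‖z - a‖ ≤ ‖1 - (starRingEnd ℂ) a * z‖ := by
  have ha1 := mem_uD.1 ha
  have hz1 := mem_uD.1 hz
  have hn : ‖(starRingEnd ℂ) a * z‖ ≤ ‖z‖ := by
    rw [norm_mul, RCLike.norm_conj]
    nlinarith [norm_nonneg z]
  refine ⟨?_, ?_, ?_⟩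
  · have := norm_sub_norm_le (1 : ℂ) ((starRingEnd ℂ) a * z)
    rw [norm_one] at this
    nlinarith [norm_nonneg z]
  · left
    have := Complex.re_le_norm ((starRingEnd ℂ) a * z)
    simp only [Complex.sub_re, Complex.one_re]
    linarith
  · apply le_of_sq_le_sq _ (norm_nonneg _)
    have e1 := Complex.sq_norm (z - a)
    have e2 := Complex.sq_norm (1 - (starRingEnd ℂ) a * z)
    have e3 := Complex.sq_norm a
    have e4 := Complex.sq_norm z
    simp only [Complex.normSq_apply, Complex.sub_re, Complex.sub_im, Complex.mul_re, Complex.mul_im,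
      Complex.conj_re, Complex.conj_im, Complex.one_re, Complex.one_im] at e1 e2 e3 e4
    have h := mul_pos (w_pos ha) (w_pos hz)
    rw [e3, e4] at h
    rw [e1, e2]
    nlinarith

lemma den_pow {α : ℝ} (hα : 1 < α) {a z : ℂ} (ha : a ∈ uD) (hz : z ∈ uD) :
    (1 - ‖z‖ ^ 2) ^ α * ‖1 - (starRingEnd ℂ) a * z‖ ^ (-α) ≤ 2 ^ α := by
  have hzp := w_pos hz
  have h1 : ‖1 - (starRingEnd ℂ) a * z‖ ^ (-α) ≤ ((1 - ‖z‖ ^ 2) / 2) ^ (-α) :=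
    Real.rpow_le_rpow_of_nonpos (by positivity) (norm_den ha hz).1 (by linarith)
  calc _ ≤ (1 - ‖z‖ ^ 2) ^ α * ((1 - ‖z‖ ^ 2) / 2) ^ (-α) :=
        mul_le_mul_of_nonneg_left h1 (by positivity)
    _ = 2 ^ α := by
      rw [Real.rpow_neg (by positivity), Real.div_rpow hzp.le (by norm_num)]
      have := (Real.rpow_pos_of_pos hzp α).ne'
      field_simp

lemma hasDeriv_pow {a z : ℂ} (c : ℂ) (ha : a ∈ uD) (hz : z ∈ uD) :
    HasDerivAt (fun z => (1 - (starRingEnd ℂ) a * z) ^ c)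
      (c * (1 - (starRingEnd ℂ) a * z) ^ (c - 1) * (-(starRingEnd ℂ) a)) z := by
  refine HasDerivAt.cpow_const (f := fun z => 1 - (starRingEnd ℂ) a * z) ?_ (norm_den ha hz).2.1
  simpa using ((hasDerivAt_id z).const_mul ((starRingEnd ℂ) a)).const_sub 1

lemma den_self {a : ℂ} : 1 - (starRingEnd ℂ) a * a = ((1 - ‖a‖ ^ 2 : ℝ) : ℂ) := by
  rw [mul_comm, Complex.mul_conj, Complex.normSq_eq_norm_sq]
  push_cast
  rfl

lemma test1 {α : ℝ} (hα : 1 < α) {a : ℂ} (ha : a ∈ uD) :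
    ∃ f, memZ α f ∧ zNorm α f ≤ 1 + (1 + α) * 2 ^ α ∧ deriv f a = 0 ∧
      ‖deriv (deriv f) a‖ = (1 - ‖a‖ ^ 2) ^ (-α) := by
  have key := test_fun (α := α) (K := (1 + α) * 2 ^ α)
    (h := fun z => (z - a) * (1 - (starRingEnd ℂ) a * z) ^ ((-α : ℝ) : ℂ))
    (h' := fun z => 1 * (1 - (starRingEnd ℂ) a * z) ^ ((-α : ℝ) : ℂ) +
      (z - a) * (((-α : ℝ) : ℂ) * (1 - (starRingEnd ℂ) a * z) ^ (((-α : ℝ) : ℂ) - 1) * (-(starRingEnd ℂ) a)))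
    (fun z hz => ((hasDerivAt_id z).sub_const a).mul (hasDeriv_pow _ ha hz)) ?_ ?_
  · obtain ⟨f, hf, hfn, hd⟩ := key
    refine ⟨f, hf, hfn, ?_, ?_⟩
    · rw [(hd a ha).1]
      simp
    · rw [(hd a ha).2]
      simp only [sub_self, zero_mul, add_zero, one_mul]
      rw [Complex.norm_cpow_real, den_self, Complex.norm_real, Real.norm_of_nonneg (w_pos ha).le]
  · intro z hz
    obtain ⟨n1, n2, n3⟩ := norm_den ha hz
    set D := 1 - (starRingEnd ℂ) a * z with hD
    have hDp : 0 < ‖D‖ := by linarith [w_pos hz]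
    have hb : ‖1 * D ^ ((-α : ℝ) : ℂ) +
      (z - a) * (((-α : ℝ) : ℂ) * D ^ (((-α : ℝ) : ℂ) - 1) * (-(starRingEnd ℂ) a))‖ ≤
        (1 + α) * ‖D‖ ^ (-α) := by
      refine (norm_add_le _ _).trans ?_
      rw [show ((-α : ℝ) : ℂ) - 1 = ((-α - 1 : ℝ) : ℂ) by push_cast; ring]
      rw [one_mul, norm_mul, norm_mul, norm_mul, norm_neg, RCLike.norm_conj, Complex.norm_cpow_real,
        Complex.norm_cpow_real, Complex.norm_real, Real.norm_eq_abs, abs_neg, abs_of_pos (by linarith),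
        Real.rpow_sub_one hDp.ne']
      have hq : 0 < ‖D‖ ^ (-α) := Real.rpow_pos_of_pos hDp _
      have h1 : ‖z - a‖ * (α * (‖D‖ ^ (-α) / ‖D‖) * ‖a‖) ≤ ‖D‖ * (α * (‖D‖ ^ (-α) / ‖D‖) * 1) := by
        have := (mem_uD.1 ha).le
        have : 0 < α := by linarith
        gcongr
      have h2 : ‖D‖ * (α * (‖D‖ ^ (-α) / ‖D‖) * 1) = α * ‖D‖ ^ (-α) := by
        field_simp
      linarith
    have hk := den_pow hα ha hz
    rw [← hD] at hk
    calc _ ≤ (1 - ‖z‖ ^ 2) ^ α * ((1 + α) * ‖D‖ ^ (-α)) :=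
          mul_le_mul_of_nonneg_left hb (Real.rpow_nonneg (w_pos hz).le _)
      _ = (1 + α) * ((1 - ‖z‖ ^ 2) ^ α * ‖D‖ ^ (-α)) := by ring
      _ ≤ _ := mul_le_mul_of_nonneg_left hk (by linarith)
  · simpa using (mem_uD.1 ha).le

lemma test2 {α : ℝ} (hα : 1 < α) {a : ℂ} (ha : a ∈ uD) :
    ∃ f, memZ α f ∧ zNorm α f ≤ 1 + (α - 1) * 2 ^ α ∧ ‖deriv f a‖ = (1 - ‖a‖ ^ 2) ^ (1 - α) := by
  have key := test_fun (α := α) (K := (α - 1) * 2 ^ α)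
    (h := fun z => (1 - (starRingEnd ℂ) a * z) ^ ((1 - α : ℝ) : ℂ))
    (h' := fun z => (((1 - α : ℝ) : ℂ) * (1 - (starRingEnd ℂ) a * z) ^ (((1 - α : ℝ) : ℂ) - 1) * (-(starRingEnd ℂ) a)))
    (fun z hz => hasDeriv_pow _ ha hz) ?_ ?_
  · obtain ⟨f, hf, hfn, hd⟩ := key
    refine ⟨f, hf, hfn, ?_⟩
    rw [(hd a ha).1, Complex.norm_cpow_real, den_self, Complex.norm_real,
      Real.norm_of_nonneg (w_pos ha).le]
  · intro z hz
    rw [show ((1 - α : ℝ) : ℂ) - 1 = ((-α : ℝ) : ℂ) by push_cast; ring]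
    rw [norm_mul, norm_mul, norm_neg, RCLike.norm_conj, Complex.norm_cpow_real, Complex.norm_real,
      Real.norm_eq_abs, abs_of_neg (by linarith), neg_sub]
    have hk := den_pow hα ha hz
    have ha1 := (mem_uD.1 ha).le
    have hα1 : 0 ≤ α - 1 := by linarith
    have hX := mul_nonneg hα1 (mul_nonneg (Real.rpow_nonneg (w_pos hz).le α)
      (Real.rpow_nonneg (norm_nonneg (1 - (starRingEnd ℂ) a * z)) (-α)))
    calc _ = ((α - 1) * ((1 - ‖z‖ ^ 2) ^ α * ‖1 - (starRingEnd ℂ) a * z‖ ^ (-α))) * ‖a‖ := by ring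
      _ ≤ ((α - 1) * ((1 - ‖z‖ ^ 2) ^ α * ‖1 - (starRingEnd ℂ) a * z‖ ^ (-α))) * 1 :=
          mul_le_mul_of_nonneg_left ha1 hX
      _ ≤ _ := by
          rw [mul_one]
          exact mul_le_mul_of_nonneg_left hk hα1
  · simp

theorem stmt_2 (α β : ℝ) (hα : 1 < α) (hβ : 0 < β)
    (φ g : ℂ → ℂ) (hφ : AnalyticOn ℂ φ uD) (hφm : Set.MapsTo φ uD uD)
    (hg : AnalyticOn ℂ g uD) :
    boundedOp α β (VgCphi g φ) ↔
      ((∃ M : ℝ, ∀ z ∈ uD, (1 - ‖z‖ ^ 2) ^ β * ‖g z * deriv φ z‖ / (1 - ‖φ z‖ ^ 2) ^ α ≤ M) ∧ (∃ M : ℝ, ∀ z ∈ uD, (1 - ‖z‖ ^ 2) ^ β * ‖deriv g z‖ / (1 - ‖φ z‖ ^ 2) ^ (α - 1) ≤ M)) := by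
  constructor
  · rintro ⟨hT, C, hC, hb⟩
    have h1 : ∀ z ∈ uD, (1 - ‖z‖ ^ 2) ^ β * ‖g z * deriv φ z‖ / (1 - ‖φ z‖ ^ 2) ^ α
        ≤ C * (1 + (1 + α) * 2 ^ α) := by
      intro z hz
      obtain ⟨f, hf, hfn, hd1, hd2⟩ := test1 hα (hφm hz)
      have hle := (zyg_le (hT f hf) hz).trans ((hb f hf).trans (mul_le_mul_of_nonneg_left hfn hC.le))
      rw [zygS, T_deriv2 hφ hφm hg hf.1 hz, hd1, zero_mul, add_zero, norm_mul, norm_mul, hd2,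
        Real.rpow_neg (w_pos (hφm hz)).le] at hle
      refine le_trans (le_of_eq ?_) hle
      rw [norm_mul]
      ring
    refine ⟨⟨_, h1⟩, C * (1 + (α - 1) * 2 ^ α) + (1 + (α - 1) * 2 ^ α) * (C * (1 + (1 + α) * 2 ^ α)), ?_⟩
    intro z hz
    obtain ⟨f, hf, hfn, hd1⟩ := test2 hα (hφm hz)
    have hle := (zyg_le (hT f hf) hz).trans ((hb f hf).trans (mul_le_mul_of_nonneg_left hfn hC.le))
    rw [zygS, T_deriv2 hφ hφm hg hf.1 hz] at hle
    have hp := w_pos (hφm hz)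
    have hzp := w_pos hz
    have hf2 := (zyg_le hf (hφm hz)).trans hfn
    rw [zygS] at hf2
    have h1z := h1 z hz
    have hP : 0 < (1 - ‖φ z‖ ^ 2) ^ α := Real.rpow_pos_of_pos hp _
    have hZ : 0 < (1 - ‖z‖ ^ 2) ^ β := Real.rpow_pos_of_pos hzp _
    have hA : (1 - ‖z‖ ^ 2) ^ β * ‖deriv (deriv f) (φ z) * deriv φ z * g z‖ ≤
        (1 + (α - 1) * 2 ^ α) * (C * (1 + (1 + α) * 2 ^ α)) := by
      calc _ = ((1 - ‖φ z‖ ^ 2) ^ α * ‖deriv (deriv f) (φ z)‖) *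
            ((1 - ‖z‖ ^ 2) ^ β * ‖g z * deriv φ z‖ / (1 - ‖φ z‖ ^ 2) ^ α) := by
              simp only [norm_mul]
              field_simp
        _ ≤ _ := mul_le_mul hf2 h1z (by positivity) (le_trans (by positivity) hf2)
    have htri : ‖deriv f (φ z) * deriv g z‖ ≤
        ‖deriv (deriv f) (φ z) * deriv φ z * g z + deriv f (φ z) * deriv g z‖ +
        ‖deriv (deriv f) (φ z) * deriv φ z * g z‖ := by
      have := norm_sub_le (deriv (deriv f) (φ z) * deriv φ z * g z + deriv f (φ z) * deriv g z)
        (deriv (deriv f) (φ z) * deriv φ z * g z)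
      rwa [add_sub_cancel_left] at this
    have htri2 := mul_le_mul_of_nonneg_left htri hZ.le
    have heq : (1 - ‖z‖ ^ 2) ^ β * ‖deriv g z‖ / (1 - ‖φ z‖ ^ 2) ^ (α - 1) =
        (1 - ‖z‖ ^ 2) ^ β * ‖deriv f (φ z) * deriv g z‖ := by
      rw [norm_mul, hd1, show 1 - α = -(α - 1) by ring, Real.rpow_neg hp.le]
      ring
    rw [heq]
    linarith
  · rintro ⟨⟨M1, h1⟩, M2, h2⟩
    have z0 : (0 : ℂ) ∈ uD := by simp [uD]
    set K := 1 + 2 ^ (α - 1) / (α - 1) with hK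
    have hα1 : 0 < α - 1 := by linarith
    have hK0 : 0 < K := by positivity
    have hM1 : 0 ≤ M1 := le_trans (div_nonneg (mul_nonneg (Real.rpow_nonneg (w_pos z0).le _)
      (norm_nonneg _)) (Real.rpow_nonneg (w_pos (hφm z0)).le _)) (h1 0 z0)
    have hM2 : 0 ≤ M2 := le_trans (div_nonneg (mul_nonneg (Real.rpow_nonneg (w_pos z0).le _)
      (norm_nonneg _)) (Real.rpow_nonneg (w_pos (hφm z0)).le _)) (h2 0 z0)
    have hbd : ∀ f, memZ α f → ∀ z ∈ uD, zygS β (VgCphi g φ f) z ≤ (M1 + K * M2) * zNorm α f := by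
      intro f hf z hz
      have hp := w_pos (hφm hz)
      have hzp := w_pos hz
      have hP : 0 < (1 - ‖φ z‖ ^ 2) ^ α := Real.rpow_pos_of_pos hp _
      have hQ : 0 < (1 - ‖φ z‖ ^ 2) ^ (α - 1) := Real.rpow_pos_of_pos hp _
      have hZ : 0 < (1 - ‖z‖ ^ 2) ^ β := Real.rpow_pos_of_pos hzp _
      have hf2 := zyg_le hf (hφm hz)
      have hN0 : 0 ≤ zNorm α f := le_trans (zyg_nonneg (hφm hz)) hf2
      have hf1 := growth hα hf (hφm hz)
      rw [zygS] at hf2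
      rw [← hK, show 1 - α = -(α - 1) by ring, Real.rpow_neg hp.le, ← div_eq_mul_inv,
        le_div_iff₀ hQ] at hf1
      have hA : (1 - ‖z‖ ^ 2) ^ β * ‖deriv (deriv f) (φ z) * deriv φ z * g z‖ ≤
          zNorm α f * M1 := by
        calc _ = ((1 - ‖φ z‖ ^ 2) ^ α * ‖deriv (deriv f) (φ z)‖) *
              ((1 - ‖z‖ ^ 2) ^ β * ‖g z * deriv φ z‖ / (1 - ‖φ z‖ ^ 2) ^ α) := by
                simp only [norm_mul]
                field_simp
          _ ≤ _ := mul_le_mul hf2 (h1 z hz) (by positivity) hN0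
      have hB : (1 - ‖z‖ ^ 2) ^ β * ‖deriv f (φ z) * deriv g z‖ ≤ K * zNorm α f * M2 := by
        calc _ = (‖deriv f (φ z)‖ * (1 - ‖φ z‖ ^ 2) ^ (α - 1)) *
              ((1 - ‖z‖ ^ 2) ^ β * ‖deriv g z‖ / (1 - ‖φ z‖ ^ 2) ^ (α - 1)) := by
                simp only [norm_mul]
                field_simp
          _ ≤ _ := mul_le_mul hf1 (h2 z hz) (by positivity) (by positivity)
      rw [zygS, T_deriv2 hφ hφm hg hf.1 hz]
      have := mul_le_mul_of_nonneg_left (norm_add_le (deriv (deriv f) (φ z) * deriv φ z * g z)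
        (deriv f (φ z) * deriv g z)) hZ.le
      nlinarith
    refine ⟨fun f hf => ⟨?_, _, hbd f hf⟩, K * (1 - ‖φ 0‖ ^ 2) ^ (1 - α) * ‖g 0‖ + (M1 + K * M2) + 1, ?_, ?_⟩
    · apply AnalyticOnNhd.analyticOn
      apply DifferentiableOn.analyticOnNhd _ isOpen_uD
      exact fun z hz => (T_props hφ hφm hg hf.1 z hz).differentiableAt.differentiableWithinAt
    · have := Real.rpow_nonneg (w_pos (hφm z0)).le (1 - α)
      positivity
    · intro f hf
      have hN0 : 0 ≤ zNorm α f := le_trans (zyg_nonneg z0) (zyg_le hf z0)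
      have hs := sSup_le_of (hbd f hf)
      have hf1 := mul_le_mul_of_nonneg_right (growth hα hf (hφm z0)) (norm_nonneg (g 0))
      rw [← hK] at hf1
      rw [zNorm, T_zero, (T_props hφ hφm hg hf.1 0 z0).deriv, norm_zero, norm_mul]
      nlinarith
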